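/- For every k ≥ 1 and every zero-mean L^∞ function φ on S¹ orthogonal to all trigonometric polynomials of degree ≤ k−1, the zero-mean primitive Iφ satisfies ‖Iφ‖_∞ ≤ (π/(2k))·‖φ‖_∞, with equality for φ(x) = sign(sin(kx)) (the derivative of the rescaled triangular cosine c_k). -/

import Mathlib

open Real MeasureTheory intervalIntegral

open Polynomial in
/-- A polynomial of degree at most `n` vanishing at `n` distinct points is a multiple of the
corresponding nodal polynomial. -/
lemma eq_C_coeff_mul_prod_of_card_zeros {q : ℝ[X]} {n : ℕ} (hq : q.degree ≤ n) (Y : Finset ℝ)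
    (hY : Y.card = n) (h0 : ∀ y ∈ Y, q.eval y = 0) :
    q = C (q.coeff n) * ∏ y ∈ Y, (X - C y) := by
  have hmonic : (∏ y ∈ Y, (X - C y)).Monic := monic_prod_of_monic _ _ fun y _ => monic_X_sub_C y
  have hdeg : (∏ y ∈ Y, (X - C y)).natDegree = n := by
    rw [natDegree_prod_of_monic _ _ fun y _ => monic_X_sub_C y]; simp [hY]
  rw [← sub_eq_zero]
  refine eq_zero_of_degree_lt_of_eval_finset_eq_zero Y ?_ fun y hy => ?_
  · rw [hY, degree_lt_iff_coeff_zero]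
    intro m hm
    rcases hm.eq_or_lt with rfl | hm
    · have := hmonic.coeff_natDegree
      rw [hdeg] at this
      simp [this]
    · have h1 : q.coeff m = 0 := coeff_eq_zero_of_degree_lt (hq.trans_lt (by exact_mod_cast hm))
      have h2 : (∏ y ∈ Y, (X - C y)).coeff m = 0 := coeff_eq_zero_of_natDegree_lt (by omega)
      simp [h1, h2]
  · rw [eval_sub, h0 y hy, eval_mul, eval_prod, Finset.prod_eq_zero hy (by simp)]
    simp

/-- Rolle's theorem for several zeros. -/
lemma exists_finset_deriv_eq_zero {f f' : ℝ → ℝ} (hf : ∀ x, HasDerivAt f (f' x) x)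
    (Z : Finset ℝ) {n : ℕ} (hZ : Z.card = n + 1) (h0 : ∀ z ∈ Z, f z = 0) :
    ∃ W : Finset ℝ, W.card = n ∧
      ∀ w ∈ W, f' w = 0 ∧ (∃ z ∈ Z, z < w) ∧ ∃ z ∈ Z, w < z := by
  let e := Z.orderEmbOfFin hZ
  have he : ∀ i, e i ∈ Z := Z.orderEmbOfFin_mem hZ
  have hlt : ∀ i : Fin n, e i.castSucc < e i.succ := fun i => e.strictMono i.castSucc_lt_succ
  have key : ∀ i : Fin n, ∃ c ∈ Set.Ioo (e i.castSucc) (e i.succ), f' c = 0 := fun i =>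
    exists_hasDerivAt_eq_zero (hlt i) (fun x _ => (hf x).continuousAt.continuousWithinAt)
      (by rw [h0 _ (he _), h0 _ (he _)]) fun x _ => hf x
  choose c hc hc0 using key
  have hmono : StrictMono c := by
    intro i j hij
    refine (hc i).2.trans_le (le_trans (e.monotone ?_) (hc j).1.le)
    rwa [Fin.succ_le_castSucc_iff]
  refine ⟨Finset.univ.map ⟨c, hmono.injective⟩, by simp, fun w hw => ?_⟩
  obtain ⟨i, -, rfl⟩ := Finset.mem_map.1 hw
  exact ⟨hc0 i, ⟨_, he _, (hc i).1⟩, _, he _, (hc i).2⟩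

lemma hasDerivAt_sawtooth_sub_trig (p : Polynomial ℝ) (k : ℕ) (c u : ℝ) :
    HasDerivAt (fun u => π - u - sin u * p.eval (cos u) - c * sin (k * u))
      ((-1 - (Polynomial.X * p - (1 - Polynomial.X ^ 2) * p.derivative)
        - Polynomial.C (c * k) * Polynomial.Chebyshev.T ℝ k : Polynomial ℝ).eval (cos u)) u := by
  have h1 := (hasDerivAt_sin u).mul ((p.hasDerivAt (cos u)).comp u (hasDerivAt_cos u))
  have h2 := (((hasDerivAt_id u).const_mul (k : ℝ)).sin).const_mul c
  have h3 := (((hasDerivAt_id u).const_sub π).sub h1).sub h2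
  convert! h3 using 1
  have hT := Polynomial.Chebyshev.T_real_cos u k
  simp only [Polynomial.eval_sub, Polynomial.eval_mul, Polynomial.eval_X, Polynomial.eval_C,
    Polynomial.eval_neg, Polynomial.eval_one, Polynomial.eval_pow, hT, id, Function.comp]
  have := sin_sq_add_cos_sq u
  push_cast
  linear_combination (-(p.derivative.eval (cos u))) * this

open Polynomial in
lemma degree_sawtooth_sub_trig_deriv {p : ℝ[X]} {k : ℕ} (hk : 1 ≤ k)
    (hp : p.degree < (k - 1 : ℕ)) :
    (-1 - (X * p - (1 - X ^ 2) * derivative p)).degree < (k : WithBot ℕ) := by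
  rw [degree_lt_iff_coeff_zero] at hp ⊢
  intro m hm
  obtain ⟨m, rfl⟩ : ∃ n, m = n + 1 := ⟨m - 1, by omega⟩
  have h1 : p.coeff m = 0 := hp m (by omega)
  have h2 : (derivative p).coeff (m + 1) = 0 := by
    rw [coeff_derivative, hp _ (by omega), zero_mul]
  have h3 : (X ^ 2 * derivative p).coeff (m + 1) = 0 := by
    rw [coeff_X_pow_mul']
    split_ifs
    · rw [coeff_derivative]
      obtain ⟨m, rfl⟩ : ∃ n, m = n + 1 := ⟨m - 1, by omega⟩
      simp only [show m + 1 + 1 - 2 + 1 = m + 1 by omega, h1, zero_mul]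
    · rfl
  rw [sub_mul, one_mul]
  simp [coeff_X_mul, h1, h2, h3, coeff_one]

open Polynomial in
/-- If `π - u - sin u * p (cos u)` with `deg p ≤ k - 2` vanishes at the points `j π / k`,
`1 ≤ j < k`, then it has the same sign as `sin (k u)` on `(0, π)`. -/
lemma div_sin_pos_of_interpolates {p : ℝ[X]} {k : ℕ} (hk : 1 ≤ k)
    (hp : p.degree < (k - 1 : ℕ))
    (hint : ∀ j : ℕ, 1 ≤ j → j < k →
      π - j * π / k - sin (j * π / k) * p.eval (cos (j * π / k)) = 0)
    {u : ℝ} (hu0 : 0 < u) (hu1 : u < π) (hu : sin (k * u) ≠ 0) :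
    0 < (π - u - sin u * p.eval (cos u)) / sin (k * u) := by
  have hk0 : (0 : ℝ) < k := by exact_mod_cast hk
  by_contra! hc
  set c := (π - u - sin u * p.eval (cos u)) / sin (k * u) with hcdef
  set f : ℝ → ℝ := fun u => π - u - sin u * p.eval (cos u) - c * sin (k * u) with hf
  set q : ℝ[X] := -1 - (X * p - (1 - X ^ 2) * derivative p) - C (c * k) * Chebyshev.T ℝ k with hq
  have hder : ∀ x, HasDerivAt f (q.eval (cos x)) x := hasDerivAt_sawtooth_sub_trig p k c
  have hfu : f u = 0 := by simp only [hf, hcdef, div_mul_cancel₀ _ hu, sub_self]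
  let N : Finset ℝ := (Finset.Icc 1 k).image fun j : ℕ => (j : ℝ) * π / k
  have hsinN : ∀ j : ℕ, sin (k * (j * π / k)) = 0 := fun j => by
    rw [show (k : ℝ) * (j * π / k) = j * π by field_simp]; exact sin_nat_mul_pi j
  have huN : u ∉ N := by
    intro h
    obtain ⟨j, -, rfl⟩ := Finset.mem_image.1 h
    exact hu (hsinN j)
  have hNcard : N.card = k := by
    rw [Finset.card_image_of_injective, Nat.card_Icc, Nat.add_sub_cancel]
    intro i j hij
    have := pi_pos
    simp only at hij
    field_simp at hij
    exact_mod_cast hij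
  have hZcard : (insert u N).card = k + 1 := by rw [Finset.card_insert_of_notMem huN, hNcard]
  have hZ0 : ∀ z ∈ insert u N, f z = 0 := by
    intro z hz
    rcases Finset.mem_insert.1 hz with rfl | hz
    · exact hfu
    obtain ⟨j, hj, rfl⟩ := Finset.mem_image.1 hz
    rw [Finset.mem_Icc] at hj
    simp only [hf, hsinN, mul_zero, sub_zero]
    rcases hj.2.eq_or_lt with rfl | hlt
    · rw [mul_div_cancel_left₀ _ hk0.ne']; simp
    · exact hint j hj.1 hlt
  have hZI : ∀ z ∈ insert u N, 0 < z ∧ z ≤ π := by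
    intro z hz
    rcases Finset.mem_insert.1 hz with rfl | hz
    · exact ⟨hu0, hu1.le⟩
    obtain ⟨j, hj, rfl⟩ := Finset.mem_image.1 hz
    rw [Finset.mem_Icc] at hj
    have h1 : (1 : ℝ) ≤ j := by exact_mod_cast hj.1
    have h2 : (j : ℝ) ≤ k := by exact_mod_cast hj.2
    have := pi_pos
    refine ⟨by positivity, ?_⟩
    rw [div_le_iff₀ hk0]
    nlinarith
  obtain ⟨W, hWcard, hW⟩ := exists_finset_deriv_eq_zero hder _ hZcard hZ0
  have hne : (insert u N).Nonempty := ⟨u, Finset.mem_insert_self _ _⟩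
  set a := (insert u N).min' hne with ha
  have haZ : a ∈ insert u N := Finset.min'_mem _ _
  have haW : ∀ w ∈ W, a < w ∧ w ≤ π := by
    intro w hw
    obtain ⟨-, ⟨z, hz, hzw⟩, z', hz', hwz'⟩ := hW w hw
    exact ⟨(Finset.min'_le _ z hz).trans_lt hzw, hwz'.le.trans (hZI z' hz').2⟩
  have ha0 := (hZI a haZ).1
  have hinj : Set.InjOn cos W := fun x hx y hy hxy =>
    injOn_cos ⟨ha0.le.trans (haW x hx).1.le, (haW x hx).2⟩
      ⟨ha0.le.trans (haW y hy).1.le, (haW y hy).2⟩ hxy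
  have hdeg0 := degree_sawtooth_sub_trig_deriv hk hp
  have hTdeg : (Chebyshev.T ℝ (k : ℤ)).natDegree = k := by simp [Chebyshev.natDegree_T]
  have hTdeg' : (Chebyshev.T ℝ (k : ℤ)).degree = k := by simp [Chebyshev.degree_T]
  have hqdeg : q.degree ≤ k := by
    refine (degree_sub_le _ _).trans (max_le hdeg0.le ?_)
    refine (degree_mul_le _ _).trans ?_
    rw [hTdeg']
    exact (add_le_add_left degree_C_le _).trans (by simp)
  have hqcoeff : 0 ≤ q.coeff k := by
    have hlead := Chebyshev.leadingCoeff_T (R := ℝ) (k : ℤ)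
    rw [leadingCoeff, hTdeg] at hlead
    rw [hq, coeff_sub, coeff_eq_zero_of_degree_lt hdeg0, coeff_C_mul, hlead, zero_sub,
      ← neg_mul]
    have : 0 ≤ -(c * k) := by nlinarith
    positivity
  have hqfac := eq_C_coeff_mul_prod_of_card_zeros hqdeg (W.image cos)
    (by rw [Finset.card_image_of_injOn hinj, hWcard]) (by
      intro y hy
      obtain ⟨w, hw, rfl⟩ := Finset.mem_image.1 hy
      exact (hW w hw).1)
  have hmono : MonotoneOn f (Set.Icc 0 a) := by
    refine monotoneOn_of_hasDerivWithinAt_nonneg (convex_Icc 0 a)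
      (fun x _ => (hder x).continuousAt.continuousWithinAt)
      (fun x _ => (hder x).hasDerivWithinAt) fun x hx => ?_
    rw [interior_Icc] at hx
    rw [hqfac, eval_mul, eval_C, eval_prod]
    refine mul_nonneg hqcoeff (Finset.prod_nonneg fun y hy => ?_)
    obtain ⟨w, hw, rfl⟩ := Finset.mem_image.1 hy
    have := cos_le_cos_of_nonneg_of_le_pi hx.1.le (haW w hw).2 (hx.2.le.trans (haW w hw).1.le)
    simpa using this
  have h1 := hmono (Set.left_mem_Icc.2 ha0.le) (Set.right_mem_Icc.2 ha0.le) ha0.le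
  rw [hZ0 a haZ] at h1
  have : f 0 = π := by simp [hf]
  linarith [pi_pos]

open Polynomial in
/-- A trigonometric polynomial of degree less than `k` whose difference to the sawtooth function
has the same sign as `sin (k u)`. -/
lemma exists_trig_approx_sawtooth {k : ℕ} (hk : 1 ≤ k) :
    ∃ p : ℝ[X], p.degree < (k - 1 : ℕ) ∧ ∀ u ∈ Set.Ioo 0 (2 * π),
      |π - u - sin u * p.eval (cos u)| =
        (π - u - sin u * p.eval (cos u)) * Real.sign (sin (k * u)) := by
  have hk0 : (0 : ℝ) < k := by exact_mod_cast hk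
  have hπ := pi_pos
  have hnode : ∀ j : ℕ, 1 ≤ j → j < k → 0 < j * π / k ∧ j * π / k < π := by
    intro j h1 h2
    have h1' : (1 : ℝ) ≤ j := by exact_mod_cast h1
    have h2' : (j : ℝ) < k := by exact_mod_cast h2
    refine ⟨by positivity, ?_⟩
    rw [div_lt_iff₀ hk0]
    nlinarith
  let v : ℕ → ℝ := fun j => cos (j * π / k)
  have hv : Set.InjOn v (Finset.Ico 1 k : Finset ℕ) := by
    intro i hi j hj hij
    rw [Finset.mem_coe, Finset.mem_Ico] at hi hj
    have h1 := hnode i hi.1 hi.2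
    have h2 := hnode j hj.1 hj.2
    have := injOn_cos ⟨h1.1.le, h1.2.le⟩ ⟨h2.1.le, h2.2.le⟩ hij
    field_simp at this
    exact_mod_cast this
  let r : ℕ → ℝ := fun j => (π - j * π / k) / sin (j * π / k)
  let p := Lagrange.interpolate (Finset.Ico 1 k) v r
  have hp : p.degree < (k - 1 : ℕ) := by
    have := Lagrange.degree_interpolate_lt (s := Finset.Ico 1 k) r hv
    rwa [Nat.card_Ico] at this
  have hint : ∀ j : ℕ, 1 ≤ j → j < k →
      π - j * π / k - sin (j * π / k) * p.eval (cos (j * π / k)) = 0 := by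
    intro j h1 h2
    have := Lagrange.eval_interpolate_at_node (s := Finset.Ico 1 k) r hv (Finset.mem_Ico.2 ⟨h1, h2⟩)
    have hs := sin_pos_of_pos_of_lt_pi (hnode j h1 h2).1 (hnode j h1 h2).2
    change p.eval (cos (j * π / k)) = (π - j * π / k) / sin (j * π / k) at this
    rw [this, mul_div_cancel₀ _ hs.ne', sub_self]
  refine ⟨p, hp, ?_⟩
  have half : ∀ u, 0 < u → u < π → |π - u - sin u * p.eval (cos u)| =
        (π - u - sin u * p.eval (cos u)) * Real.sign (sin (k * u)) := by
    intro u hu0 hu1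
    rcases lt_trichotomy (sin (k * u)) 0 with h | h | h
    · have := div_sin_pos_of_interpolates hk hp hint hu0 hu1 h.ne
      have h' : π - u - sin u * p.eval (cos u) < 0 := by
        by_contra! h'
        exact absurd (div_nonpos_of_nonneg_of_nonpos h' h.le) (not_le.2 this)
      rw [Real.sign_of_neg h, abs_of_neg h']; ring
    · obtain ⟨n, hn⟩ := sin_eq_zero_iff.1 h
      have hu : u = n * π / k := by field_simp; linarith
      have hn0 : 0 < n := by
        have : (0 : ℝ) < n := by
          by_contra! hn'
          have : k * u > 0 := by positivity
          nlinarith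
        exact_mod_cast this
      have hnk : n < k := by
        have : (n : ℝ) < k := by
          by_contra! hn'
          have : k * u < k * π := by gcongr
          nlinarith
        exact_mod_cast this
      lift n to ℕ using hn0.le
      have := hint n (by omega) (by omega)
      simp only [Int.cast_natCast] at hu
      rw [← hu] at this
      simp [this]
    · have := div_sin_pos_of_interpolates hk hp hint hu0 hu1 h.ne'
      rw [div_pos_iff_of_pos_right h] at this
      rw [Real.sign_of_pos h, abs_of_pos this, mul_one]
  intro u hu
  rcases lt_trichotomy u π with h | rfl | h
  · exact half u hu.1 h
  · simp
  · have := half (2 * π - u) (by linarith [hu.2]) (by linarith)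
    have e : sin (k * (2 * π - u)) = - sin (k * u) := by
      rw [← sin_nat_mul_two_pi_sub (k * u) k]; ring_nf
    rw [sin_two_pi_sub, cos_two_pi_sub, e, Real.sign_neg,
      show π - (2 * π - u) - -sin u * p.eval (cos u) = -(π - u - sin u * p.eval (cos u)) by ring,
      abs_neg, neg_mul_neg] at this
    exact this

lemma intervalIntegrable_of_abs_le {φ : ℝ → ℝ} (hφ : Measurable φ) {M : ℝ}
    (hM : ∀ x, |φ x| ≤ M) (a b : ℝ) : IntervalIntegrable φ volume a b :=
  intervalIntegrable_const.mono_fun' (g := fun _ => M) hφ.aestronglyMeasurable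
    (.of_forall fun x => by simpa using hM x)

/-- Trigonometric polynomials of degree less than `n`. -/
def trigPolys (n : ℕ) : Submodule ℝ (ℝ → ℝ) :=
  Submodule.span ℝ {f | ∃ j < n, ∃ a : ℝ, f = fun t => cos (j * t + a)}

lemma trigPolys_mono {m n : ℕ} (h : m ≤ n) : trigPolys m ≤ trigPolys n :=
  Submodule.span_mono fun _ ⟨j, hj, a, hf⟩ => ⟨j, hj.trans_le h, a, hf⟩

lemma cos_mem_trigPolys {j n : ℕ} (hj : j < n) (a : ℝ) :
    (fun t => cos (j * t + a)) ∈ trigPolys n :=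
  Submodule.subset_span ⟨j, hj, a, rfl⟩

lemma cos_mul_mem_trigPolys (b : ℝ) {n : ℕ} {f : ℝ → ℝ} (hf : f ∈ trigPolys n) :
    (fun t => cos (t + b) * f t) ∈ trigPolys (n + 1) := by
  induction hf using Submodule.span_induction with
  | mem f h =>
    obtain ⟨j, hj, a, rfl⟩ := h
    obtain ⟨i, hi, a', h'⟩ : ∃ i < n + 1, ∃ a' : ℝ, ∀ t : ℝ,
        cos (i * t + a') = cos ((j * t + a) - (t + b)) := by
      rcases j with - | j
      · refine ⟨1, by omega, b - a, fun t => ?_⟩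
        rw [← cos_neg]; congr 1; push_cast; ring
      · refine ⟨j, by omega, a - b, fun t => ?_⟩
        congr 1; push_cast; ring
    have h1 := cos_mem_trigPolys (show j + 1 < n + 1 by omega) (a + b)
    have h2 := cos_mem_trigPolys hi a'
    convert! Submodule.smul_mem _ (1 / 2 : ℝ) (Submodule.add_mem _ h1 h2) using 1
    ext t
    have e : cos ((j + 1 : ℕ) * t + (a + b)) = cos ((j * t + a) + (t + b)) := by
      congr 1; push_cast; ring
    simp only [Pi.smul_apply, Pi.add_apply, smul_eq_mul, h', e]
    rw [cos_add (j * t + a), cos_sub (j * t + a)]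
    ring
  | zero =>
    simp only [Pi.zero_apply, mul_zero]
    exact Submodule.zero_mem _
  | add f g _ _ hf hg =>
    convert! Submodule.add_mem _ hf hg using 1
    ext t; simp [mul_add]
  | smul c f _ hf =>
    convert! Submodule.smul_mem _ c hf using 1
    ext t; simp [mul_left_comm]

lemma cos_pow_mem_trigPolys (b : ℝ) (m : ℕ) :
    (fun t => cos (t + b) ^ m) ∈ trigPolys (m + 1) := by
  induction m with
  | zero => simpa using cos_mem_trigPolys zero_lt_one 0
  | succ m ih => simpa only [pow_succ'] using cos_mul_mem_trigPolys b ih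

lemma sin_mul_eval_cos_mem_trigPolys {p : Polynomial ℝ} {k : ℕ} (hp : p.degree < (k - 1 : ℕ))
    (x : ℝ) : (fun t => sin (x - t) * p.eval (cos (x - t))) ∈ trigPolys k := by
  have hsin : ∀ t, sin (x - t) = cos (t + (π / 2 - x)) := fun t => by
    rw [← cos_pi_div_two_sub]; congr 1; ring
  have hcos : ∀ t, cos (x - t) = cos (t + -x) := fun t => by
    rw [← cos_neg]; congr 1; ring
  have h : (fun t => sin (x - t) * p.eval (cos (x - t))) =
      ∑ m ∈ p.support, p.coeff m • fun t => cos (t + (π / 2 - x)) * cos (t + -x) ^ m := by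
    ext t
    rw [hsin, hcos, Polynomial.eval_eq_sum, Polynomial.sum, Finset.mul_sum, Finset.sum_apply]
    exact Finset.sum_congr rfl fun m _ => by simp [mul_left_comm]
  rw [h]
  refine Submodule.sum_mem _ fun m hm => Submodule.smul_mem _ _ ?_
  have hm' : m < k - 1 := by
    have := (Polynomial.le_degree_of_mem_supp m hm).trans_lt hp
    exact_mod_cast this
  exact trigPolys_mono (by omega) (cos_mul_mem_trigPolys _ (cos_pow_mem_trigPolys _ m))

lemma continuous_of_mem_trigPolys {n : ℕ} {f : ℝ → ℝ} (hf : f ∈ trigPolys n) :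
    Continuous f := by
  induction hf using Submodule.span_induction with
  | mem f h => obtain ⟨j, -, a, rfl⟩ := h; fun_prop
  | zero => exact continuous_zero
  | add f g _ _ hf hg => exact hf.add hg
  | smul c f _ hf => exact hf.const_smul c

lemma integral_mul_cos_add {φ : ℝ → ℝ} (hφ : IntervalIntegrable φ volume 0 (2 * π)) (j : ℕ)
    (a : ℝ) : ∫ x in (0 : ℝ)..(2 * π), φ x * cos (j * x + a) =
      cos a * (∫ x in (0 : ℝ)..(2 * π), φ x * cos (j * x)) -
        sin a * ∫ x in (0 : ℝ)..(2 * π), φ x * sin (j * x) := by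
  rw [← intervalIntegral.integral_const_mul, ← intervalIntegral.integral_const_mul,
    ← intervalIntegral.integral_sub]
  · refine intervalIntegral.integral_congr fun x _ => ?_
    simp only [cos_add]
    ring
  · exact (hφ.mul_continuousOn (by fun_prop)).const_mul _
  · exact (hφ.mul_continuousOn (by fun_prop)).const_mul _

lemma integral_mul_eq_zero_of_mem_trigPolys {φ : ℝ → ℝ} {k : ℕ}
    (hφ : IntervalIntegrable φ volume 0 (2 * π))
    (horth : ∀ j : ℕ, j < k →
        (∫ x in (0:ℝ)..(2 * π), φ x * Real.cos (j * x)) = 0 ∧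
        (∫ x in (0:ℝ)..(2 * π), φ x * Real.sin (j * x)) = 0)
    {f : ℝ → ℝ} (hf : f ∈ trigPolys k) : ∫ x in (0 : ℝ)..(2 * π), φ x * f x = 0 := by
  induction hf using Submodule.span_induction with
  | mem f h =>
    obtain ⟨j, hj, a, rfl⟩ := h
    rw [integral_mul_cos_add hφ, (horth j hj).1, (horth j hj).2]
    simp
  | zero => simp
  | add f g hf hg hf' hg' =>
    simp only [Pi.add_apply, mul_add]
    rw [intervalIntegral.integral_add
      (hφ.mul_continuousOn (continuous_of_mem_trigPolys hf).continuousOn)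
      (hφ.mul_continuousOn (continuous_of_mem_trigPolys hg).continuousOn), hf', hg', add_zero]
  | smul c f hf hf' =>
    simp only [Pi.smul_apply, smul_eq_mul, mul_left_comm _ c]
    rw [intervalIntegral.integral_const_mul, hf', mul_zero]

lemma integral_pi_sub_mul {ψ G : ℝ → ℝ} (hψ : IntervalIntegrable ψ volume 0 (2 * π))
    (hG : ∀ u, G u = G 0 + ∫ t in (0 : ℝ)..u, ψ t) :
    ∫ u in (0 : ℝ)..(2 * π), (π - u) * ψ u =
      -π * (G 0 + G (2 * π)) + ∫ u in (0 : ℝ)..(2 * π), G u := by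
  have hF := hψ.absolutelyContinuousOnInterval_intervalIntegral (c := 0) (by simp)
  have hB : AbsolutelyContinuousOnInterval (fun u : ℝ => π - u) 0 (2 * π) :=
    ContDiffOn.absolutelyContinuousOnInterval (by fun_prop)
  have h := hB.integral_mul_deriv_eq_deriv_mul hF
  have h1 : ∫ u in (0 : ℝ)..(2 * π), (π - u) * ψ u =
      ∫ u in (0 : ℝ)..(2 * π), (π - u) * deriv (fun u => ∫ t in (0 : ℝ)..u, ψ t) u := by
    refine intervalIntegral.integral_congr_ae ?_
    filter_upwards [hψ.ae_hasDerivAt_integral] with u hu hu'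
    rw [(hu (Set.uIoc_subset_uIcc hu') 0 (by simp)).deriv]
  have h2 : ∫ u in (0 : ℝ)..(2 * π), G u =
      2 * π * G 0 + ∫ u in (0 : ℝ)..(2 * π), ∫ t in (0 : ℝ)..u, ψ t := by
    rw [intervalIntegral.integral_congr fun u _ => hG u, intervalIntegral.integral_add
      intervalIntegrable_const hF.continuousOn.intervalIntegrable]
    simp
  have h3 : ∀ u : ℝ, deriv (fun u : ℝ => π - u) u = -1 := fun u => by simp
  simp only [h3] at h
  rw [h1, h, h2, hG (2 * π)]
  simp
  ring

lemma periodic_of_eq_add_integral {φ Φ : ℝ → ℝ} (hφ : ∀ a b, IntervalIntegrable φ volume a b)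
    (hper : Function.Periodic φ (2 * π)) (h0 : ∫ x in (0 : ℝ)..(2 * π), φ x = 0)
    (hΦ : ∀ x, Φ x = Φ 0 + ∫ t in (0 : ℝ)..x, φ t) : Function.Periodic Φ (2 * π) := by
  intro x
  rw [hΦ (x + 2 * π), hΦ x, ← intervalIntegral.integral_add_adjacent_intervals (hφ 0 x) (hφ x _),
    hper.intervalIntegral_add_eq x 0, zero_add, h0, add_zero]

/-- A zero-mean primitive as a convolution with the sawtooth function. -/
lemma two_pi_mul_primitive {φ Φ : ℝ → ℝ} (hφ : ∀ a b, IntervalIntegrable φ volume a b)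
    (hper : Function.Periodic φ (2 * π)) (h0 : ∫ x in (0 : ℝ)..(2 * π), φ x = 0)
    (hΦ : ∀ x, Φ x = Φ 0 + ∫ t in (0 : ℝ)..x, φ t)
    (hmean : ∫ x in (0 : ℝ)..(2 * π), Φ x = 0) (x : ℝ) :
    2 * π * Φ x = ∫ u in (0 : ℝ)..(2 * π), (π - u) * φ (x - u) := by
  have hΦper := periodic_of_eq_add_integral hφ hper h0 hΦ
  have hG : ∀ u, -Φ (x - u) = -Φ (x - 0) + ∫ t in (0 : ℝ)..u, φ (x - t) := by
    intro u
    rw [intervalIntegral.integral_comp_sub_left (fun t => φ t) x, sub_zero, hΦ (x - u), hΦ x,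
      ← intervalIntegral.integral_add_adjacent_intervals (hφ 0 (x - u)) (hφ (x - u) x)]
    ring
  have hψ : IntervalIntegrable (fun u => φ (x - u)) volume 0 (2 * π) := by
    have := (hφ x (x - 2 * π)).comp_sub_left x
    simpa using this
  rw [integral_pi_sub_mul hψ hG, intervalIntegral.integral_neg,
    intervalIntegral.integral_comp_sub_left (fun t => Φ t) x]
  have h1 := hΦper.intervalIntegral_add_eq (x - 2 * π) 0
  rw [sub_add_cancel, zero_add, hmean] at h1
  rw [sub_zero, h1, hΦper.sub_eq]
  ring

lemma integral_comp_sub_left_of_periodic {f : ℝ → ℝ} (hf : Function.Periodic f (2 * π)) (x : ℝ) :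
    ∫ u in (0 : ℝ)..(2 * π), f (x - u) = ∫ u in (0 : ℝ)..(2 * π), f u := by
  rw [intervalIntegral.integral_comp_sub_left f x]
  have h1 := hf.intervalIntegral_add_eq (x - 2 * π) 0
  rw [sub_add_cancel, zero_add] at h1
  rw [sub_zero, h1]

/-- The sawtooth kernel may be modified by a trigonometric polynomial of low degree. -/
lemma two_pi_mul_primitive_of_orthogonal {k : ℕ} (hk : 1 ≤ k) {p : Polynomial ℝ}
    (hp : p.degree < (k - 1 : ℕ)) {φ Φ : ℝ → ℝ}
    (hφ : ∀ a b, IntervalIntegrable φ volume a b) (hper : Function.Periodic φ (2 * π))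
    (horth : ∀ j : ℕ, j < k →
        (∫ x in (0:ℝ)..(2 * π), φ x * Real.cos (j * x)) = 0 ∧
        (∫ x in (0:ℝ)..(2 * π), φ x * Real.sin (j * x)) = 0)
    (hΦ : ∀ x, Φ x = Φ 0 + ∫ t in (0 : ℝ)..x, φ t)
    (hmean : ∫ x in (0 : ℝ)..(2 * π), Φ x = 0) (x : ℝ) :
    2 * π * Φ x =
      ∫ u in (0 : ℝ)..(2 * π), (π - u - sin u * p.eval (cos u)) * φ (x - u) := by
  have h0 : ∫ x in (0 : ℝ)..(2 * π), φ x = 0 := by simpa using (horth 0 hk).1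
  have hψ : IntervalIntegrable (fun u => φ (x - u)) volume 0 (2 * π) := by
    have := (hφ x (x - 2 * π)).comp_sub_left x
    simpa using this
  have hperT : Function.Periodic (fun t => φ t * (sin (x - t) * p.eval (cos (x - t))))
      (2 * π) := by
    intro t
    simp only [hper t, ← sub_sub, sin_sub_two_pi, cos_sub_two_pi]
  have hT := integral_mul_eq_zero_of_mem_trigPolys (hφ 0 _) horth
    (sin_mul_eval_cos_mem_trigPolys hp x)
  rw [← integral_comp_sub_left_of_periodic hperT x] at hT
  simp only [sub_sub_cancel] at hT
  rw [two_pi_mul_primitive hφ hper h0 hΦ hmean x]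
  refine (sub_zero _).symm.trans ?_
  nth_rewrite 2 [← hT]
  rw [← intervalIntegral.integral_sub (hψ.continuousOn_mul (by fun_prop))
      (hψ.mul_continuousOn ?_)]
  · exact intervalIntegral.integral_congr fun u _ => by ring
  · exact (continuous_sin.mul (p.continuous.comp continuous_cos)).continuousOn

lemma measurable_real_sign : Measurable Real.sign :=
  Measurable.ite measurableSet_Iio measurable_const
    (Measurable.ite measurableSet_Ioi measurable_const measurable_const)

lemma abs_real_sign_le_one (x : ℝ) : |Real.sign x| ≤ 1 := by
  rcases Real.sign_apply_eq x with h | h | h <;> simp [h]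

lemma intervalIntegrable_sign_sin (k : ℕ) (a b : ℝ) :
    IntervalIntegrable (fun t => Real.sign (sin (k * t))) volume a b :=
  intervalIntegrable_of_abs_le (measurable_real_sign.comp (by fun_prop))
    (fun _ => abs_real_sign_le_one _) a b

lemma periodic_sign_sin (k : ℕ) : Function.Periodic (fun t => Real.sign (sin (k * t))) (2 * π) := by
  intro t
  simp only [mul_add, sin_add_nat_mul_two_pi]

lemma sign_sin_add_pi_div {k : ℕ} (hk : 1 ≤ k) (t : ℝ) :
    Real.sign (sin (k * (t + π / k))) = -Real.sign (sin (k * t)) := by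
  have hk0 : (k : ℝ) ≠ 0 := by positivity
  rw [mul_add, mul_div_cancel₀ _ hk0, sin_add_pi, Real.sign_neg]

lemma integral_sign_sin_mul_cos {k j : ℕ} (hk : 1 ≤ k) (hj : j < k) :
    (∫ x in (0:ℝ)..(2 * π), Real.sign (sin (k * x)) * Real.cos (j * x)) = 0 ∧
    (∫ x in (0:ℝ)..(2 * π), Real.sign (sin (k * x)) * Real.sin (j * x)) = 0 := by
  have hk0 : (0 : ℝ) < k := by exact_mod_cast hk
  have hexp := integral_mul_cos_add (intervalIntegrable_sign_sin k 0 (2 * π)) j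
  set A := ∫ x in (0:ℝ)..(2 * π), Real.sign (sin (k * x)) * Real.cos (j * x)
  set B := ∫ x in (0:ℝ)..(2 * π), Real.sign (sin (k * x)) * Real.sin (j * x)
  set θ := j * π / k with hθ
  have hanti : ∀ a, ∫ x in (0:ℝ)..(2 * π), Real.sign (sin (k * x)) * cos (j * x + a) =
      -∫ x in (0:ℝ)..(2 * π), Real.sign (sin (k * x)) * cos (j * x + (a + θ)) := by
    intro a
    have hper : Function.Periodic (fun x => Real.sign (sin (k * x)) * cos (j * x + a))
        (2 * π) := by
      intro t
      have h := periodic_sign_sin k t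
      simp only at h ⊢
      rw [h, mul_add, add_right_comm, cos_add_nat_mul_two_pi]
    have h1 := hper.intervalIntegral_add_eq (π / k) 0
    rw [zero_add, add_comm, ← zero_add (π / k), ← add_assoc, add_zero,
      ← intervalIntegral.integral_comp_add_right] at h1
    rw [← h1, ← intervalIntegral.integral_neg]
    refine intervalIntegral.integral_congr fun x _ => ?_
    simp only [sign_sin_add_pi_div hk]
    rw [show j * (x + π / k) + a = j * x + (a + θ) by rw [hθ]; ring, neg_mul]
  have h1 := hanti 0
  have h2 := hanti (π / 2)
  rw [hexp, hexp] at h1 h2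
  simp only [zero_add, cos_zero, sin_zero, cos_pi_div_two, sin_pi_div_two, add_comm (π / 2) θ,
    cos_add_pi_div_two, sin_add_pi_div_two] at h1 h2
  have hsc := sin_sq_add_cos_sq θ
  have hcos : -1 < cos θ := by
    rw [← cos_pi]
    refine cos_lt_cos_of_nonneg_of_le_pi (by positivity) le_rfl ?_
    rw [hθ, div_lt_iff₀ hk0, mul_comm]
    have : (j : ℝ) < k := by exact_mod_cast hj
    exact mul_lt_mul_of_pos_left this pi_pos
  have hne : 2 * (1 + cos θ) ≠ 0 := by linarith
  constructor
  · refine (mul_eq_zero.1 (?_ : 2 * (1 + cos θ) * A = 0)).resolve_left hne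
    linear_combination (1 + cos θ) * h1 - sin θ * h2 - A * hsc
  · refine (mul_eq_zero.1 (?_ : 2 * (1 + cos θ) * B = 0)).resolve_left hne
    linear_combination (-sin θ) * h1 - (1 + cos θ) * h2 - B * hsc

/-- The value at `0` of the zero-mean primitive of `sign (sin (k x))`. -/
lemma primitive_sign_sin_zero {k : ℕ} (hk : 1 ≤ k) {Φ : ℝ → ℝ}
    (hΦ : ∀ x : ℝ, Φ x = Φ 0 + ∫ t in (0:ℝ)..x, Real.sign (Real.sin (k * t)))
    (hmean : (∫ x in (0:ℝ)..(2 * π), Φ x) = 0) : Φ 0 = -(π / (2 * k)) := by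
  have hk0 : (0 : ℝ) < k := by exact_mod_cast hk
  have hπ := pi_pos
  have hint := intervalIntegrable_sign_sin k
  have hΦper : Function.Periodic Φ (2 * π) :=
    periodic_of_eq_add_integral hint (periodic_sign_sin k)
      (by simpa using (integral_sign_sin_mul_cos (j := 0) hk hk).1) hΦ
  have hΦcont : Continuous Φ := by
    rw [funext hΦ]
    exact continuous_const.add (intervalIntegral.continuous_primitive hint 0)
  have hsum : ∀ x, Φ (x + π / k) + Φ x = Φ (π / k) + Φ 0 := by
    intro x
    have h : ∫ t in (π / k)..(x + π / k), Real.sign (sin (k * t)) =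
        -∫ t in (0 : ℝ)..x, Real.sign (sin (k * t)) := by
      have := intervalIntegral.integral_comp_add_right (a := 0) (b := x)
        (fun t => Real.sign (sin (k * t))) (π / k)
      rw [zero_add] at this
      rw [← this, ← intervalIntegral.integral_neg]
      exact intervalIntegral.integral_congr fun t _ => sign_sin_add_pi_div hk t
    rw [hΦ (x + π / k), hΦ x, hΦ (π / k),
      ← intervalIntegral.integral_add_adjacent_intervals (hint 0 (π / k)) (hint (π / k) _), h]
    ring
  have hshift : ∫ x in (0 : ℝ)..(2 * π), Φ (x + π / k) = 0 := by
    rw [intervalIntegral.integral_comp_add_right, add_comm (2 * π), zero_add,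
      hΦper.intervalIntegral_add_eq _ 0, zero_add, hmean]
  have hzero : Φ (π / k) + Φ 0 = 0 := by
    have h := intervalIntegral.integral_congr (μ := volume) (a := 0) (b := 2 * π)
      fun x _ => hsum x
    have hcont : Continuous fun x => Φ (x + π / k) := hΦcont.comp (continuous_add_const _)
    rw [intervalIntegral.integral_add (hcont.intervalIntegrable _ _)
      (hΦcont.intervalIntegrable _ _), hshift, hmean, intervalIntegral.integral_const] at h
    simp only [sub_zero, smul_eq_mul, add_zero] at h
    exact (mul_eq_zero.1 h.symm).resolve_left (by positivity)
  have hstep : ∫ t in (0 : ℝ)..(π / k), Real.sign (sin (k * t)) = π / k := by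
    have h : ∫ t in (0 : ℝ)..(π / k), Real.sign (sin (k * t)) = ∫ t in (0 : ℝ)..(π / k), 1 := by
      refine intervalIntegral.integral_congr_ae ?_
      filter_upwards [Measure.ae_ne volume (π / k)] with t ht ht'
      rw [Set.uIoc_of_le (by positivity)] at ht'
      have : t < π / k := lt_of_le_of_ne ht'.2 ht
      rw [lt_div_iff₀ hk0, mul_comm] at this
      exact Real.sign_of_pos (sin_pos_of_pos_of_lt_pi (mul_pos hk0 ht'.1) this)
    rw [h]
    simp
  have h := hΦ (π / k)
  rw [hstep] at h
  have hhalf : π / (2 * k) = π / k / 2 := by ring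
  linarith

/-- The sharp bound, for the value at a point. -/
lemma abs_primitive_le {k : ℕ} (hk : 1 ≤ k) {φ Φ : ℝ → ℝ} (hmeas : Measurable φ) {M : ℝ}
    (hM : ∀ x, |φ x| ≤ M) (hper : Function.Periodic φ (2 * π))
    (horth : ∀ j : ℕ, j < k →
        (∫ x in (0:ℝ)..(2 * π), φ x * Real.cos (j * x)) = 0 ∧
        (∫ x in (0:ℝ)..(2 * π), φ x * Real.sin (j * x)) = 0)
    (hΦ : ∀ x, Φ x = Φ 0 + ∫ t in (0 : ℝ)..x, φ t)
    (hmean : ∫ x in (0 : ℝ)..(2 * π), Φ x = 0) (x : ℝ) : |Φ x| ≤ π / (2 * k) * M := by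
  have hk0 : (0 : ℝ) < k := by exact_mod_cast hk
  have hπ := pi_pos
  obtain ⟨p, hp, hsign⟩ := exists_trig_approx_sawtooth hk
  have hφ := intervalIntegrable_of_abs_le hmeas hM
  have hs := intervalIntegrable_sign_sin k
  set D : ℝ → ℝ := fun u => π - u - sin u * p.eval (cos u) with hD
  have hDcont : Continuous D :=
    (by fun_prop : Continuous fun u : ℝ => π - u).sub
      (continuous_sin.mul (p.continuous.comp continuous_cos))
  have hDnorm : ∫ u in (0 : ℝ)..(2 * π), |D u| = π ^ 2 / k := by
    set F : ℝ → ℝ := fun x => ∫ t in (0 : ℝ)..x, Real.sign (sin (k * t))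
    have hFcont : Continuous F := intervalIntegral.continuous_primitive hs 0
    set m := (∫ x in (0 : ℝ)..(2 * π), F x) / (2 * π) with hm
    have hΨ : ∀ x, F x - m = (F 0 - m) + ∫ t in (0 : ℝ)..x, Real.sign (sin (k * t)) := by
      intro x
      simp only [F, intervalIntegral.integral_same]
      ring
    have hΨmean : ∫ x in (0 : ℝ)..(2 * π), (F x - m) = 0 := by
      rw [intervalIntegral.integral_sub (hFcont.intervalIntegrable _ _) intervalIntegrable_const,
        intervalIntegral.integral_const, smul_eq_mul, sub_zero, hm,
        mul_div_cancel₀ _ (by positivity), sub_self]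
    have h1 := two_pi_mul_primitive_of_orthogonal hk hp hs (periodic_sign_sin k)
      (fun j hj => integral_sign_sin_mul_cos hk hj) hΨ hΨmean 0
    rw [primitive_sign_sin_zero hk hΨ hΨmean] at h1
    have h2 : ∫ u in (0 : ℝ)..(2 * π), |D u| =
        -∫ u in (0 : ℝ)..(2 * π), D u * Real.sign (sin (k * (0 - u))) := by
      rw [← intervalIntegral.integral_neg]
      refine intervalIntegral.integral_congr_ae ?_
      filter_upwards [Measure.ae_ne volume (2 * π)] with u hu hu'
      rw [Set.uIoc_of_le (by positivity)] at hu'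
      rw [hsign u ⟨hu'.1, lt_of_le_of_ne hu'.2 hu⟩, zero_sub, mul_neg, sin_neg, Real.sign_neg,
        mul_neg, neg_neg]
    rw [h2, ← h1]
    field_simp
  have hψ : IntervalIntegrable (fun u => φ (x - u)) volume 0 (2 * π) := by
    have := (hφ x (x - 2 * π)).comp_sub_left x
    simpa using this
  have hbound : |2 * π * Φ x| ≤ π ^ 2 / k * M := by
    rw [two_pi_mul_primitive_of_orthogonal hk hp hφ hper horth hΦ hmean x, ← hDnorm,
      ← intervalIntegral.integral_mul_const]
    refine (intervalIntegral.abs_integral_le_integral_abs (by positivity)).trans ?_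
    refine intervalIntegral.integral_mono_on (by positivity)
      (hψ.continuousOn_mul hDcont.continuousOn).abs
      ((hDcont.abs.mul continuous_const).intervalIntegrable _ _) fun u _ => ?_
    rw [abs_mul]
    exact mul_le_mul_of_nonneg_left (hM _) (abs_nonneg _)
  rw [abs_mul, abs_of_pos (by positivity : 0 < 2 * π)] at hbound
  refine le_of_mul_le_mul_left (hbound.trans_eq ?_) (by positivity : 0 < 2 * π)
  field_simp

/-- **Sharp bound on the zero-mean primitive on `𝒯_k`.**
For every bounded measurable 2π-periodic `φ` orthogonal to all trigonometric
polynomials of degree ≤ k−1, the zero-mean primitive `Φ = Iφ` satisfies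
`‖Iφ‖_∞ ≤ (π/2k)·‖φ‖_∞`, with equality for `φ(x) = sign(sin(kx))`. -/
theorem primitive_sharp_bound (k : ℕ) (hk : 1 ≤ k) :
    (∀ φ Φ : ℝ → ℝ, Measurable φ → (∃ M, ∀ x, |φ x| ≤ M) →
      Function.Periodic φ (2 * π) →
      (∀ j : ℕ, j < k →
        (∫ x in (0:ℝ)..(2 * π), φ x * Real.cos (j * x)) = 0 ∧
        (∫ x in (0:ℝ)..(2 * π), φ x * Real.sin (j * x)) = 0) →
      (∀ x : ℝ, Φ x = Φ 0 + ∫ t in (0:ℝ)..x, φ t) →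
      (∫ x in (0:ℝ)..(2 * π), Φ x) = 0 →
      (⨆ x : ℝ, |Φ x|) ≤ (π / (2 * k)) * ⨆ x : ℝ, |φ x|) ∧
    (∀ Φ₀ : ℝ → ℝ,
      (∀ x : ℝ, Φ₀ x = Φ₀ 0 + ∫ t in (0:ℝ)..x, Real.sign (Real.sin (k * t))) →
      (∫ x in (0:ℝ)..(2 * π), Φ₀ x) = 0 →
      (⨆ x : ℝ, |Φ₀ x|) = (π / (2 * k)) * ⨆ x : ℝ, |Real.sign (Real.sin (k * x))|) := by
  have hk0 : (0 : ℝ) < k := by exact_mod_cast hk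
  have hπ := pi_pos
  refine ⟨fun φ Φ hmeas ⟨M, hM⟩ hper horth hΦ hmean => ?_, fun Φ₀ hΦ hmean => ?_⟩
  · have hbdd : BddAbove (Set.range fun x => |φ x|) := ⟨M, by rintro _ ⟨x, rfl⟩; exact hM x⟩
    exact ciSup_le fun x => abs_primitive_le hk hmeas (le_ciSup hbdd) hper horth hΦ hmean x
  · have hle := abs_primitive_le hk (measurable_real_sign.comp (by fun_prop))
      (fun x => abs_real_sign_le_one (sin (k * x))) (periodic_sign_sin k)
      (fun j hj => integral_sign_sin_mul_cos hk hj) hΦ hmean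
    rw [mul_one] at hle
    have hsup : ⨆ x : ℝ, |Real.sign (Real.sin (k * x))| = 1 := by
      refine le_antisymm (ciSup_le fun x => abs_real_sign_le_one _) ?_
      refine le_ciSup_of_le ⟨1, by rintro _ ⟨x, rfl⟩; exact abs_real_sign_le_one _⟩ (π / 2 / k) ?_
      rw [mul_div_cancel₀ _ hk0.ne', sin_pi_div_two, Real.sign_one, abs_one]
    rw [hsup, mul_one]
    refine le_antisymm (ciSup_le hle) ?_
    refine le_ciSup_of_le ⟨π / (2 * k), by rintro _ ⟨x, rfl⟩; exact hle x⟩ 0 ?_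
    rw [primitive_sign_sin_zero hk hΦ hmean, abs_neg, abs_of_pos (by positivity)]
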